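/- arXiv:0907.1431 — 3 statements merged into one kernel-verified Lean document; each statement's English description precedes it below -/
import Mathlib

section
/- Let H be a separable real Hilbert space and let (μ_n) be a sequence of Borel probability measures on H converging τ_w-weakly to a Borel probability measure μ. Suppose there is a measurable function G : H → [0,∞] such that for every c ∈ [0,∞) the sublevel set {x ∈ H : G(x) ≤ c} is compact in the norm topology of H, and sup_n ∫_H G dμ_n < ∞. Then μ_n converges to μ weakly in the usual sense, i.e., ∫_H φ dμ_n → ∫_H φ dμ for every bounded φ : H → ℝ that is continuous with respect to the norm topology. -/
open MeasureTheory Filter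
open scoped ENNReal

/-- A function `f : H → ℝ` is weakly continuous if it is continuous with respect to
the weak topology `σ(H,H)` on `H`. -/
def WeaklyContinuous {H : Type*} [NormedAddCommGroup H] [InnerProductSpace ℝ H]
    (f : H → ℝ) : Prop :=
  Continuous fun x : WeakSpace ℝ H => f x

lemma aux_bound {H : Type*} [NormedAddCommGroup H] [MeasurableSpace H] [BorelSpace H]
    [SecondCountableTopology H]
    (ρ : Measure H) [IsProbabilityMeasure ρ] (φ ψ : H → ℝ) (hφ : Continuous φ)
    (hψ : Continuous ψ) (C : ℝ) (hC : ∀ x, |φ x| ≤ C) (hC' : ∀ x, |ψ x| ≤ C)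
    (K : Set H) (hK : ∀ x ∈ K, φ x = ψ x) (δ : ℝ) (hδ : ρ.real Kᶜ ≤ δ) :
    |∫ x, φ x ∂ρ - ∫ x, ψ x ∂ρ| ≤ 2 * C * δ := by
  have hC0 : 0 ≤ C := (abs_nonneg _).trans (hC 0)
  have i1 : Integrable φ ρ := Integrable.of_bound hφ.aestronglyMeasurable C
    (Eventually.of_forall hC)
  have i2 : Integrable ψ ρ := Integrable.of_bound hψ.aestronglyMeasurable C
    (Eventually.of_forall hC')
  rw [← integral_sub i1 i2]
  rw [← setIntegral_eq_integral_of_forall_compl_eq_zero (s := Kᶜ)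
    (fun x hx => by
      rw [hK x (by simpa using hx), sub_self])]
  have := norm_setIntegral_le_of_norm_le_const (μ := ρ) (s := Kᶜ)
    (f := fun x => φ x - ψ x) (C := 2 * C) (measure_lt_top _ _)
    (fun x _ => by
      have := abs_sub (φ x) (ψ x)
      have h1 := hC x
      have h2 := hC' x
      rw [Real.norm_eq_abs]
      linarith)
  exact this.trans (mul_le_mul_of_nonneg_left hδ (by linarith))

theorem stmt_7
    {H : Type*} [NormedAddCommGroup H] [InnerProductSpace ℝ H]
    [TopologicalSpace.SeparableSpace H] [MeasurableSpace H] [BorelSpace H]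
    (μ : ℕ → Measure H) (ν : Measure H)
    (hμ : ∀ n, IsProbabilityMeasure (μ n)) (hν : IsProbabilityMeasure ν)
    (hconv : ∀ f : H → ℝ, (∃ C : ℝ, ∀ x, |f x| ≤ C) → WeaklyContinuous f →
      Tendsto (fun n => ∫ x, f x ∂(μ n)) atTop (nhds (∫ x, f x ∂ν)))
    (G : H → ℝ≥0∞) (hGmeas : Measurable G)
    (hGcomp : ∀ c : ℝ≥0∞, c ≠ ∞ → IsCompact {x : H | G x ≤ c})
    (hGsup : (⨆ n, ∫⁻ x, G x ∂(μ n)) < ∞) :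
    ∀ φ : H → ℝ, (∃ C : ℝ, ∀ x, |φ x| ≤ C) → Continuous φ →
      Tendsto (fun n => ∫ x, φ x ∂(μ n)) atTop (nhds (∫ x, φ x ∂ν)) := by
  rintro φ ⟨C, hC⟩ hφ
  have hC0 : 0 ≤ C := (abs_nonneg _).trans (hC 0)
  have : SecondCountableTopology H := UniformSpace.secondCountable_of_separable H
  let e : ℕ → H := TopologicalSpace.denseSeq H
  let T : H → (ℕ → ℝ) := fun x k => inner ℝ (e k) x
  have hTc : Continuous T := by
    apply continuous_pi; intro k; exact continuous_const.inner continuous_id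
  have hTw : Continuous (fun x : WeakSpace ℝ H => T x) := by
    apply continuous_pi; intro k
    exact WeakBilin.eval_continuous (topDualPairing ℝ H).flip (innerSL ℝ (e k))
  have hTi : Function.Injective T := by
    intro x y hxy
    refine ext_inner_left ℝ fun v => ?_
    refine (TopologicalSpace.denseRange_denseSeq H).induction_on
      (p := fun v => inner ℝ v x = inner ℝ v y) v ?_ ?_
    · exact isClosed_eq (by fun_prop) (by fun_prop)
    · intro k; exact congrFun hxy k
  -- weak convergence of the images
  have hTm : Measurable T := hTc.measurable
  have key : ∀ ψ : BoundedContinuousFunction (ℕ → ℝ) ℝ,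
      Tendsto (fun n => ∫ x, ψ (T x) ∂(μ n)) atTop (nhds (∫ x, ψ (T x) ∂ν)) := by
    intro ψ
    exact hconv (fun x => ψ (T x)) ⟨‖ψ‖, fun x => ψ.norm_coe_le_norm _⟩
      (ψ.continuous.comp hTw)
  let P : ℕ → ProbabilityMeasure (ℕ → ℝ) := fun n =>
    ⟨(μ n).map T, Measure.isProbabilityMeasure_map hTm.aemeasurable⟩
  let Q : ProbabilityMeasure (ℕ → ℝ) :=
    ⟨ν.map T, Measure.isProbabilityMeasure_map hTm.aemeasurable⟩
  have hPQ : Tendsto P atTop (nhds Q) := by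
    rw [ProbabilityMeasure.tendsto_iff_forall_integral_tendsto]
    intro ψ
    have h : ∀ ρ : Measure H, ∫ y, ψ y ∂(ρ.map T) = ∫ x, ψ (T x) ∂ρ := fun ρ =>
      integral_map hTm.aemeasurable ψ.continuous.aestronglyMeasurable
    simpa [P, Q, h] using key ψ
  rw [Metric.tendsto_atTop]
  intro ε hε
  -- choose the compact set
  set M := (⨆ n, ∫⁻ x, G x ∂(μ n)) with hM
  obtain ⟨δ, hδ, hδε⟩ : ∃ δ : ℝ, 0 < δ ∧ 2 * C * δ < ε / 3 := by
    refine ⟨ε / (3 * (2 * C + 1)), by positivity, ?_⟩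
    rw [mul_div_assoc', div_lt_div_iff₀ (by positivity) (by positivity)]
    nlinarith
  let c : ℝ≥0∞ := M / ENNReal.ofReal δ + 1
  have hδ' : ENNReal.ofReal δ ≠ 0 := by simpa using hδ
  have hc : c ≠ ∞ :=
    ENNReal.add_ne_top.2 ⟨ENNReal.div_ne_top hGsup.ne hδ', ENNReal.one_ne_top⟩
  have hc0 : c ≠ 0 := by simp [c]
  let K : Set H := {x | G x ≤ c}
  have hK : IsCompact K := hGcomp c hc
  have hμK : ∀ n, μ n Kᶜ ≤ ENNReal.ofReal δ := by
    intro n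
    have h1 : c * μ n Kᶜ ≤ M := by
      calc c * μ n Kᶜ ≤ c * μ n {x | c ≤ G x} := by
            gcongr
            intro x hx
            have hx' : ¬ G x ≤ c := hx
            exact (not_le.1 hx').le
        _ ≤ ∫⁻ x, G x ∂(μ n) := mul_meas_ge_le_lintegral hGmeas c
        _ ≤ M := le_iSup (fun n => ∫⁻ x, G x ∂(μ n)) n
    have h2 : M ≤ c * ENNReal.ofReal δ := by
      calc M = M / ENNReal.ofReal δ * ENNReal.ofReal δ :=
            (ENNReal.div_mul_cancel hδ' ENNReal.ofReal_ne_top).symm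
        _ ≤ _ := by gcongr; exact le_self_add
    exact (ENNReal.mul_le_mul_iff_right hc0 hc).1 (h1.trans h2)
  have hmap : ∀ ρ : Measure H, ρ.map T (T '' K)ᶜ = ρ Kᶜ := by
    intro ρ
    rw [Measure.map_apply hTm (hK.image hTc).isClosed.measurableSet.compl,
      Set.preimage_compl, Set.preimage_image_eq _ hTi]
  have hνK : ν Kᶜ ≤ ENNReal.ofReal δ := by
    have := ProbabilityMeasure.le_liminf_measure_open_of_tendsto hPQ
      (hK.image hTc).isClosed.isOpen_compl
    have h3 : ν Kᶜ ≤ atTop.liminf fun n => μ n Kᶜ := by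
      simpa [P, Q, hmap] using this
    refine h3.trans ((liminf_le_liminf (Eventually.of_forall hμK)).trans ?_)
    simp
  have toR : ∀ ρ : Measure H, ρ Kᶜ ≤ ENNReal.ofReal δ → ρ.real Kᶜ ≤ δ := fun ρ h =>
    ENNReal.toReal_le_of_le_ofReal hδ.le h
  -- extension
  have : CompactSpace K := isCompact_iff_compactSpace.1 hK
  have hemb : Topology.IsClosedEmbedding (fun x : K => T x) :=
    (hTc.comp continuous_subtype_val).isClosedEmbedding
      (hTi.comp Subtype.val_injective)
  let f : BoundedContinuousFunction K ℝ :=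
    BoundedContinuousFunction.ofNormedAddCommGroup (fun x : K => φ x)
      (hφ.comp continuous_subtype_val) C (fun x => hC x)
  have hf : ‖f‖ ≤ C := BoundedContinuousFunction.norm_ofNormedAddCommGroup_le _ hC0 _
  obtain ⟨ψ, hψn, hψ⟩ :=
    BoundedContinuousFunction.exists_extension_norm_eq_of_isClosedEmbedding f hemb
  have hψC : ∀ x, |ψ (T x)| ≤ C := fun x => (ψ.norm_coe_le_norm _).trans (hψn.le.trans hf)
  have hψK : ∀ x ∈ K, φ x = ψ (T x) := fun x hx => (congrFun hψ ⟨x, hx⟩).symm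
  have hψc : Continuous fun x => ψ (T x) := ψ.continuous.comp hTc
  obtain ⟨N, hN⟩ := Metric.tendsto_atTop.1 (key ψ) (ε / 3) (by positivity)
  refine ⟨N, fun n hn => ?_⟩
  have a1 := hN n hn
  have a2 := aux_bound (μ n) φ _ hφ hψc C hC hψC K hψK δ (toR _ (hμK n))
  have a3 := aux_bound ν φ _ hφ hψc C hC hψC K hψK δ (toR _ hνK)
  rw [Real.dist_eq] at a1 ⊢
  rw [abs_lt] at a1 ⊢
  rw [abs_le] at a2 a3
  constructor <;> linarith [a1.1, a1.2, a2.1, a2.2, a3.1, a3.2]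
end

section
/- Let H be a real Hilbert space, D ⊆ H a linear subspace, and A : D → H a linear map satisfying ⟨Au,u⟩ ≤ 0 for all u ∈ D. Let s < t be real numbers, let g : [s,t] → H be continuous, and let Y : [s,t] → H be continuous with Y(r) ∈ D for r ∈ (s,t) and such that Y is differentiable on (s,t) with Y′(r) = A(Y(r)) + g(r) for all r ∈ (s,t). Then ‖Y(t)‖² ≤ e^{t−s}‖Y(s)‖² + ∫_s^t e^{t−r}‖g(r)‖² dr. -/
open Set
open scoped RealInnerProductSpace

/-- Energy estimate: if `A : D → H` is linear with `⟨Au,u⟩ ≤ 0`, `g` is continuous and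
`Y` is a continuous solution of `Y′ = A Y + g` on `(s,t)`, then
`‖Y(t)‖² ≤ e^{t−s}‖Y(s)‖² + ∫_s^t e^{t−r}‖g(r)‖² dr`. -/
theorem stmt_9
    {H : Type*} [NormedAddCommGroup H] [InnerProductSpace ℝ H]
    (D : Submodule ℝ H) (A : D →ₗ[ℝ] H)
    (hA : ∀ u : D, ⟪A u, (u : H)⟫ ≤ 0)
    (s t : ℝ) (hst : s < t)
    (g Y : ℝ → H)
    (hg : ContinuousOn g (Icc s t))
    (hY : ContinuousOn Y (Icc s t))
    (hYD : ∀ r ∈ Ioo s t, Y r ∈ D)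
    (hderiv : ∀ r (hr : r ∈ Ioo s t), HasDerivAt Y (A ⟨Y r, hYD r hr⟩ + g r) r) :
    ‖Y t‖ ^ 2 ≤ Real.exp (t - s) * ‖Y s‖ ^ 2 + ∫ r in s..t, Real.exp (t - r) * ‖g r‖ ^ 2 := by
  have hexp : ∀ r : ℝ, HasDerivAt (fun r => Real.exp (t - r)) (-Real.exp (t - r)) r := by
    intro r
    have h := ((hasDerivAt_id r).const_sub t).exp
    simpa using h
  have hcexp : Continuous (fun r : ℝ => Real.exp (t - r)) := by fun_prop
  have key := intervalIntegral.sub_le_integral_of_hasDeriv_right_of_le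
    (a := s) (b := t) (g := fun r => Real.exp (t - r) * ‖Y r‖ ^ 2)
    (g' := fun r => -Real.exp (t - r) * ‖Y r‖ ^ 2 + Real.exp (t - r) * (2 * ⟪Y r, deriv Y r⟫))
    (φ := fun r => Real.exp (t - r) * ‖g r‖ ^ 2) hst.le
    (hcexp.continuousOn.mul (hY.norm.pow 2))
    (fun r hr => by
      have hd : HasDerivAt Y (deriv Y r) r := (hderiv r hr).differentiableAt.hasDerivAt
      exact ((hexp r).mul hd.norm_sq).hasDerivWithinAt)
    ((hcexp.continuousOn.mul (hg.norm.pow 2)).integrableOn_Icc)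
    (fun r hr => by
      have h1 := hA ⟨Y r, hYD r hr⟩
      have h2 : 2 * ⟪Y r, g r⟫ ≤ ‖Y r‖ ^ 2 + ‖g r‖ ^ 2 := by
        have := norm_sub_sq_real (Y r) (g r)
        nlinarith [sq_nonneg ‖Y r - g r‖]
      have h3 : 2 * ⟪Y r, deriv Y r⟫ ≤ ‖Y r‖ ^ 2 + ‖g r‖ ^ 2 := by
        rw [(hderiv r hr).deriv, inner_add_right, real_inner_comm]
        try simp only at h1
        linarith
      have h4 := mul_le_mul_of_nonneg_left h3 (Real.exp_pos (t - r)).le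
      beta_reduce
      linarith)
  simp only [sub_self, Real.exp_zero, one_mul] at key
  linarith
end

section
/- Let f : ℝ → ℝ be continuous and K ∈ ℝ be such that (f(a) − f(b))(a − b) ≤ K(a − b)² for all a, b ∈ ℝ, and let λ > K. Then for every g ∈ ℝ there exists a unique z ∈ ℝ with λz − f(z) = g; i.e., the map z ↦ λz − f(z) is a bijection of ℝ onto ℝ. -/
/-- Range condition for a continuous quasi-dissipative function on `ℝ`: if
`(f(a) − f(b))(a − b) ≤ K(a − b)²` for all `a, b` and `λ > K`, then `z ↦ λz − f(z)`
is a bijection of `ℝ` onto `ℝ`. -/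
theorem stmt_14
    (f : ℝ → ℝ) (hf : Continuous f) (K : ℝ)
    (hdiss : ∀ a b : ℝ, (f a - f b) * (a - b) ≤ K * (a - b) ^ 2)
    (lam : ℝ) (hlam : K < lam) :
    ∀ g : ℝ, ∃! z : ℝ, lam * z - f z = g := by
  intro g
  have hc : 0 < lam - K := sub_pos.mpr hlam
  have key : ∀ a b : ℝ, b ≤ a →
      (lam - K) * (a - b) ≤ (lam * a - f a) - (lam * b - f b) := by
    intro a b hab
    rcases hab.eq_or_lt with rfl | hlt
    · simp
    · have hpos : 0 < a - b := sub_pos.mpr hlt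
      have h1 : f a - f b ≤ K * (a - b) := by
        refine le_of_mul_le_mul_right ?_ hpos
        calc (f a - f b) * (a - b) ≤ K * (a - b) ^ 2 := hdiss a b
          _ = K * (a - b) * (a - b) := by ring
      linarith
  have hcont : Continuous fun z : ℝ => lam * z - f z := by fun_prop
  obtain ⟨M, hM⟩ : ∃ M : ℝ, M = |g - (lam * 0 - f 0)| / (lam - K) := ⟨_, rfl⟩
  have hM0 : 0 ≤ M := by rw [hM]; positivity
  have hcM : (lam - K) * M = |g - (lam * 0 - f 0)| := by
    rw [hM]; field_simp
  have hup := key M 0 hM0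
  have hlo := key 0 (-M) (by linarith)
  have e1 := le_abs_self (g - (lam * 0 - f 0))
  have e2 := neg_abs_le (g - (lam * 0 - f 0))
  have hmem : g ∈ Set.Icc (lam * (-M) - f (-M)) (lam * M - f M) := by
    constructor <;> linarith
  obtain ⟨z, -, hz⟩ := intermediate_value_Icc (by linarith : -M ≤ M) hcont.continuousOn hmem
  refine ⟨z, hz, ?_⟩
  intro y hy
  have hz' : lam * z - f z = g := hz
  have hy' : lam * y - f y = g := hy
  rcases lt_trichotomy y z with h | h | h
  · have h1 := key z y h.le
    have h2 := mul_pos hc (sub_pos.mpr h)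
    linarith
  · exact h
  · have h1 := key y z h.le
    have h2 := mul_pos hc (sub_pos.mpr h)
    linarith
end
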